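/- Suppose φ ∈ L¹(ℝ) satisfies ∫_ℝ e^{iπnt} φ(t) dt = 0 and ∫_ℝ e^{−iπn/t} φ(t) dt = 0 for every integer n ∈ ℤ. Then φ = 0 almost everywhere on ℝ. -/

import Mathlib

open MeasureTheory

open Set
open scoped ENNReal

theorem integral_mul_continuousMap_eq_zero {φ : ℝ → ℂ} (hφ : Integrable φ)
    (h : ∀ n : ℤ, ∫ t : ℝ, Complex.exp (Complex.I * (Real.pi : ℂ) * (n : ℂ) * (t : ℂ)) * φ t = 0)
    (g : C(AddCircle (2 : ℝ), ℂ)) : ∫ t : ℝ, φ t * g t = 0 := by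
  have : Fact ((0 : ℝ) < 2) := ⟨two_pos⟩
  have hint (g : C(AddCircle (2 : ℝ), ℂ)) : Integrable fun t : ℝ => φ t * g t :=
    hφ.mul_bdd (c := ‖g‖) (g.continuous.comp (AddCircle.continuous_mk' 2)).aestronglyMeasurable
      (Filter.Eventually.of_forall fun t => g.norm_coe_le_norm _)
  let L : C(AddCircle (2 : ℝ), ℂ) →ₗ[ℂ] ℂ :=
    { toFun := fun g => ∫ t : ℝ, φ t * g t
      map_add' := fun f g => by
        simp only [ContinuousMap.add_apply, mul_add]
        exact integral_add (hint f) (hint g)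
      map_smul' := fun c g => by
        simp only [ContinuousMap.smul_apply, smul_eq_mul, RingHom.id_apply, mul_left_comm _ c]
        exact integral_const_mul _ _ }
  let L' := L.mkContinuous (∫ t, ‖φ t‖) fun g => by
    rw [← integral_mul_const]
    refine norm_integral_le_of_norm_le (hφ.norm.mul_const _) (Filter.Eventually.of_forall fun t => ?_)
    rw [norm_mul]
    gcongr
    exact g.norm_coe_le_norm _
  have hker : (Submodule.span ℂ (range <| @fourier 2)).topologicalClosure ≤ L'.ker := by
    refine Submodule.topologicalClosure_minimal _ ?_ L'.isClosed_ker
    rw [Submodule.span_le]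
    rintro _ ⟨n, rfl⟩
    change ∫ t : ℝ, φ t * fourier n (t : AddCircle (2 : ℝ)) = 0
    rw [← h n]
    congr 1 with t
    rw [fourier_coe_apply, mul_comm]
    congr 2
    push_cast
    ring
  rw [span_fourier_closure_eq_top] at hker
  exact hker (Submodule.mem_top (x := g))

theorem integral_mul_measurable_eq_zero {φ : ℝ → ℂ} (hφ : Integrable φ) (hm : Measurable φ)
    (h : ∀ n : ℤ, ∫ t : ℝ, Complex.exp (Complex.I * (Real.pi : ℂ) * (n : ℂ) * (t : ℂ)) * φ t = 0)
    {a : AddCircle (2 : ℝ) → ℂ} (ha : Measurable a) {C : ℝ} (hC : ∀ x, ‖a x‖ ≤ C) :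
    ∫ t : ℝ, φ t * a t = 0 := by
  have : Fact ((0 : ℝ) < 2) := ⟨two_pos⟩
  have hmk : Measurable ((↑) : ℝ → AddCircle (2 : ℝ)) := AddCircle.measurable_mk'
  let m : Measure (AddCircle (2 : ℝ)) :=
    (volume.withDensity fun t => (‖φ t‖₊ : ℝ≥0∞)).map ((↑) : ℝ → AddCircle (2 : ℝ))
  have : IsFiniteMeasure (volume.withDensity fun t => (‖φ t‖₊ : ℝ≥0∞)) :=
    isFiniteMeasure_withDensity hφ.2.ne
  have : IsFiniteMeasure m := Measure.isFiniteMeasure_map _ _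
  have hai : Integrable a m :=
    Integrable.of_bound ha.aestronglyMeasurable C (Filter.Eventually.of_forall hC)
  rw [← norm_le_zero_iff]
  refine le_of_forall_pos_le_add fun ε hε => ?_
  obtain ⟨g, hg, -⟩ := hai.exists_boundedContinuous_integral_sub_le hε
  have hgz := integral_mul_continuousMap_eq_zero hφ h g.toContinuousMap
  have hga : Integrable fun t : ℝ => φ t * g t :=
    hφ.mul_bdd (c := ‖g‖) (g.continuous.comp (AddCircle.continuous_mk' 2)).aestronglyMeasurable
      (Filter.Eventually.of_forall fun t => g.norm_coe_le_norm _)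
  have haa : Integrable fun t : ℝ => φ t * a t :=
    hφ.mul_bdd (c := C) (ha.comp hmk).aestronglyMeasurable
      (Filter.Eventually.of_forall fun t => hC _)
  have e : ∫ t : ℝ, φ t * a t = ∫ t : ℝ, φ t * (a t - g t) := by
    simp only [mul_sub]
    rw [integral_sub haa hga]
    exact (sub_zero _).symm.trans (congrArg _ hgz.symm)
  rw [e, zero_add]
  refine (norm_integral_le_integral_norm _).trans (le_trans (le_of_eq ?_) hg)
  rw [integral_map (f := fun x => ‖a x - g x‖) hmk.aemeasurable
    (ha.sub g.continuous.measurable).norm.aestronglyMeasurable,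
    integral_withDensity_eq_integral_smul hm.nnnorm]
  congr 1 with t
  rw [norm_mul]
  rfl

theorem lintegral_eq_tsum_Ioc (f : ℝ → ℝ≥0∞) :
    ∫⁻ t, f t = ∑' j : ℤ, ∫⁻ t in Ioc (-1 : ℝ) 1, f (t + 2 * j) := by
  have hU := iUnion_Ioc_add_zsmul (two_pos : (0 : ℝ) < 2) (-1)
  rw [← setLIntegral_univ, ← hU, lintegral_iUnion (fun _ => measurableSet_Ioc)
    (pairwise_disjoint_Ioc_add_zsmul (-1 : ℝ) 2)]
  congr 1 with j
  rw [← (measurePreserving_add_right volume (2 * (j : ℝ))).setLIntegral_comp_preimage_emb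
    (MeasurableEquiv.addRight _).measurableEmbedding]
  congr 2
  ext t
  simp only [mem_preimage, mem_Ioc, zsmul_eq_mul]
  push_cast
  constructor <;> rintro ⟨h1, h2⟩ <;> constructor <;> linarith

theorem hasSum_inv_mul_add_two {x : ℝ} (hx : 0 < x) :
    HasSum (fun n : ℕ => ((x + 2 * n) * (x + 2 * n + 2))⁻¹) (2 * x)⁻¹ := by
  rw [hasSum_iff_tendsto_nat_of_nonneg (fun n => by positivity)]
  have h (n : ℕ) : ∑ i ∈ Finset.range n, ((x + 2 * i) * (x + 2 * i + 2))⁻¹ =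
      (2 * x)⁻¹ - (2 * (x + 2 * n))⁻¹ := by
    induction n with
    | zero => simp
    | succ n ih =>
      rw [Finset.sum_range_succ, ih]
      push_cast
      have : x + 2 * n ≠ 0 := by positivity
      have : x + 2 * (n + 1) ≠ 0 := by positivity
      have : x + 2 * n + 2 ≠ 0 := by positivity
      field_simp
      ring
  simp_rw [h]
  have : Filter.Tendsto (fun n : ℕ => (2 * (x + 2 * (n : ℝ)))⁻¹) Filter.atTop (nhds 0) := by
    refine Filter.Tendsto.inv_tendsto_atTop ?_
    refine Filter.Tendsto.const_mul_atTop two_pos ?_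
    refine Filter.tendsto_atTop_add_const_left _ _ ?_
    exact Filter.Tendsto.const_mul_atTop two_pos tendsto_natCast_atTop_atTop
  simpa using this.const_sub (2 * x)⁻¹

theorem hasSum_inv_abs_one_sub_sq {t : ℝ} (ht : t ∈ Ioo (-1 : ℝ) 1) :
    HasSum (fun j : ℤ => if j = 0 then 0 else |1 - (t + 2 * j) ^ 2|⁻¹) |1 - t ^ 2|⁻¹ := by
  obtain ⟨h1, h2⟩ := ht
  have e : |1 - t ^ 2|⁻¹ = (2 * (1 + t))⁻¹ + 0 + (2 * (1 - t))⁻¹ := by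
    have : (1 + t) ≠ 0 := by linarith
    have : (1 - t) ≠ 0 := by linarith
    have e : 1 - t ^ 2 = (1 + t) * (1 - t) := by ring
    rw [abs_of_pos (by nlinarith), e]
    field_simp
    ring
  rw [e]
  refine HasSum.of_add_one_of_neg_add_one ?_ ?_
  · convert hasSum_inv_mul_add_two (by linarith : 0 < 1 + t) using 2 with n
    have hn : (0 : ℝ) ≤ n := n.cast_nonneg
    rw [if_neg (by omega), abs_of_neg (by push_cast; nlinarith)]
    push_cast
    ring
  · convert hasSum_inv_mul_add_two (by linarith : 0 < 1 - t) using 2 with n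
    have hn : (0 : ℝ) ≤ n := n.cast_nonneg
    rw [if_neg (by omega), abs_of_neg (by push_cast; nlinarith)]
    push_cast
    ring

theorem lintegral_compl_Ioc_eq {g : AddCircle (2 : ℝ) → ℝ≥0∞} (hg : Measurable g) :
    ∫⁻ t in (Ioc (-1 : ℝ) 1)ᶜ, g t * ENNReal.ofReal |1 - t ^ 2|⁻¹ =
      ∫⁻ t in Ioc (-1 : ℝ) 1, g t * ENNReal.ofReal |1 - t ^ 2|⁻¹ := by
  have hmk : Measurable ((↑) : ℝ → AddCircle (2 : ℝ)) := AddCircle.measurable_mk'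
  have hF : Measurable ((Ioc (-1 : ℝ) 1)ᶜ.indicator
      fun t : ℝ => g t * ENNReal.ofReal |1 - t ^ 2|⁻¹) :=
    ((hg.comp hmk).mul (by fun_prop)).indicator measurableSet_Ioc.compl
  have hFj (j : ℤ) : Measurable fun t => (Ioc (-1 : ℝ) 1)ᶜ.indicator
      (fun t : ℝ => g t * ENNReal.ofReal |1 - t ^ 2|⁻¹) (t + 2 * j) :=
    hF.comp (measurable_add_const _)
  rw [← lintegral_indicator measurableSet_Ioc.compl, lintegral_eq_tsum_Ioc,
    ← lintegral_tsum fun j => (hFj j).aemeasurable, ← restrict_Ioo_eq_restrict_Ioc]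
  refine setLIntegral_congr_fun measurableSet_Ioo fun t ht => ?_
  have hs := hasSum_inv_abs_one_sub_sq ht
  rw [← hs.tsum_eq, ENNReal.ofReal_tsum_of_nonneg (fun j => by split_ifs <;> positivity)
    hs.summable, ← ENNReal.tsum_mul_left]
  congr 1 with j
  by_cases hj : j = 0
  · subst hj
    rw [indicator_of_notMem (by simpa using ⟨ht.1, ht.2.le⟩)]
    simp
  · have hper : ((t + 2 * j : ℝ) : AddCircle (2 : ℝ)) = t := by
      rw [AddCircle.coe_add, mul_comm, ← zsmul_eq_mul, AddCircle.coe_zsmul, AddCircle.coe_period,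
        smul_zero, add_zero]
    rw [indicator_of_mem, hper, if_neg hj]
    rw [mem_compl_iff, mem_Ioc]
    rintro ⟨h1, h2⟩
    have h3 := ht.1
    have h4 := ht.2
    have : (j : ℝ) < 1 := by linarith
    have : (-1 : ℝ) < j := by linarith
    norm_cast at *
    omega

/-- The representative in `(-1, 1]` of a point of `ℝ / 2ℤ`. -/
noncomputable def circleRep (x : AddCircle (2 : ℝ)) : ℝ :=
  haveI : Fact ((0 : ℝ) < 2) := ⟨two_pos⟩
  AddCircle.measurableEquivIoc 2 (-1) x

theorem measurable_circleRep : Measurable circleRep :=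
  haveI : Fact ((0 : ℝ) < 2) := ⟨two_pos⟩
  measurable_subtype_coe.comp (AddCircle.measurableEquivIoc 2 (-1)).measurable

theorem circleRep_coe {t : ℝ} (ht : t ∈ Ioc (-1 : ℝ) 1) : circleRep t = t := by
  have : Fact ((0 : ℝ) < 2) := ⟨two_pos⟩
  have ht' : t ∈ Ioc (-1 : ℝ) (-1 + 2) := ⟨ht.1, by linarith [ht.2]⟩
  exact congrArg Subtype.val (AddCircle.equivIoc_coe_eq ht')

/-- The bracket `√(1 + |z|²)`. -/
noncomputable def bracket (z : ℂ) : ℝ := √(1 + ‖z‖ ^ 2)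

theorem continuous_bracket : Continuous bracket := by
  unfold bracket
  fun_prop

theorem sq_bracket (z : ℂ) : bracket z ^ 2 = 1 + ‖z‖ ^ 2 := Real.sq_sqrt (by positivity)

theorem one_le_bracket (z : ℂ) : 1 ≤ bracket z :=
  Real.one_le_sqrt.2 (by nlinarith [sq_nonneg ‖z‖])

theorem bracket_pos (z : ℂ) : 0 < bracket z := one_pos.trans_le (one_le_bracket z)

theorem norm_le_bracket (z : ℂ) : ‖z‖ ≤ bracket z :=
  Real.le_sqrt_of_sq_le (by linarith)

theorem bracket_le_one_add_norm (z : ℂ) : bracket z ≤ 1 + ‖z‖ :=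
  Real.sqrt_le_iff.2 ⟨by positivity, by nlinarith [norm_nonneg z]⟩

theorem one_sub_inv_bracket_le (z : ℂ) : 1 - (bracket z)⁻¹ ≤ ‖z‖ := by
  have h1 := bracket_le_one_add_norm z
  have h2 := one_le_bracket z
  have h3 := bracket_pos z
  have h4 : 1 - (bracket z)⁻¹ = (bracket z - 1) / bracket z := by field_simp
  rw [h4]
  exact (div_le_self (by linarith) h2).trans (by linarith)

theorem sq_bracket_mul_bracket (z w : ℂ) : (bracket z * bracket w) ^ 2 =
    (1 + (star z * w).re) ^ 2 + (star z * w).im ^ 2 + ‖z - w‖ ^ 2 := by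
  rw [mul_pow, sq_bracket, sq_bracket]
  simp only [Complex.sq_norm, Complex.normSq_apply]
  simp
  ring

theorem one_add_re_le_bracket_mul_bracket (z w : ℂ) :
    1 + (star z * w).re ≤ bracket z * bracket w := by
  refine le_of_abs_le (abs_le_of_sq_le_sq ?_ (mul_pos (bracket_pos z) (bracket_pos w)).le)
  rw [sq_bracket_mul_bracket]
  nlinarith [sq_nonneg (star z * w).im, sq_nonneg ‖z - w‖]

theorem eq_of_bracket_mul_bracket_eq {z w : ℂ}
    (h : bracket z * bracket w = 1 + (star z * w).re) : w = z := by
  have := sq_bracket_mul_bracket z w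
  rw [h] at this
  have h0 : ‖z - w‖ ^ 2 ≤ 0 := by nlinarith [sq_nonneg (star z * w).im]
  have : ‖z - w‖ = 0 := by nlinarith [norm_nonneg (z - w)]
  exact (sub_eq_zero.1 (norm_eq_zero.1 this)).symm

/-- The function `(1 - t²) φ(t)`. -/
noncomputable def weighted (φ : ℝ → ℂ) (t : ℝ) : ℂ := φ t * (1 - t ^ 2 : ℝ)

/-- The strictly convex density `(√(1 + |(1 - t²) φ(t)|²) - 1) / |1 - t²|`, dominated by `|φ|`. -/
noncomputable def energy (φ : ℝ → ℂ) (t : ℝ) : ℝ := (bracket (weighted φ t) - 1) * |1 - t ^ 2|⁻¹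

theorem measurable_weighted {φ : ℝ → ℂ} (hm : Measurable φ) : Measurable (weighted φ) := by
  unfold weighted
  fun_prop

theorem norm_weighted_mul_inv_le (φ : ℝ → ℂ) (t : ℝ) :
    ‖weighted φ t‖ * |1 - t ^ 2|⁻¹ ≤ ‖φ t‖ := by
  rw [weighted, norm_mul, Complex.norm_real, Real.norm_eq_abs, mul_assoc]
  exact mul_le_of_le_one_right (norm_nonneg _) mul_inv_le_one

theorem measurable_energy {φ : ℝ → ℂ} (hm : Measurable φ) : Measurable (energy φ) :=
  ((continuous_bracket.measurable.comp (measurable_weighted hm)).sub_const 1).mul (by fun_prop)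

theorem energy_nonneg (φ : ℝ → ℂ) (t : ℝ) : 0 ≤ energy φ t :=
  mul_nonneg (sub_nonneg.2 (one_le_bracket _)) (by positivity)

theorem integrable_energy {φ : ℝ → ℂ} (hφ : Integrable φ) (hm : Measurable φ) :
    Integrable (energy φ) := by
  refine hφ.norm.mono' (measurable_energy hm).aestronglyMeasurable
    (Filter.Eventually.of_forall fun t => ?_)
  rw [Real.norm_eq_abs, abs_of_nonneg (energy_nonneg φ t)]
  refine le_trans ?_ (norm_weighted_mul_inv_le φ t)
  unfold energy
  gcongr
  linarith [bracket_le_one_add_norm (weighted φ t)]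

/-- If `φ` annihilates the 2-periodic exponentials, its energy outside `(-1, 1]` is at least its
energy inside, and equality forces `(1 - t²) φ(t)` to be 2-periodic. -/
theorem setIntegral_energy_le_compl {φ : ℝ → ℂ} (hφ : Integrable φ) (hm : Measurable φ)
    (h : ∀ n : ℤ, ∫ t : ℝ, Complex.exp (Complex.I * (Real.pi : ℂ) * (n : ℂ) * (t : ℂ)) * φ t = 0) :
    (∫ t in Ioc (-1 : ℝ) 1, energy φ t) ≤ ∫ t in (Ioc (-1 : ℝ) 1)ᶜ, energy φ t ∧
    ((∫ t in (Ioc (-1 : ℝ) 1)ᶜ, energy φ t) ≤ ∫ t in Ioc (-1 : ℝ) 1, energy φ t →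
      ∀ᵐ t : ℝ, t ∈ (Ioc (-1 : ℝ) 1)ᶜ → weighted φ t = weighted φ (circleRep t)) := by
  have hmk : Measurable ((↑) : ℝ → AddCircle (2 : ℝ)) := AddCircle.measurable_mk'
  set z : AddCircle (2 : ℝ) → ℂ := fun x => weighted φ (circleRep x) with hz
  have hzm : Measurable z := (measurable_weighted hm).comp measurable_circleRep
  have hNm : Measurable fun x => bracket (z x) := continuous_bracket.measurable.comp hzm
  set a : AddCircle (2 : ℝ) → ℂ := fun x => star (z x) * ((bracket (z x))⁻¹ : ℝ) with ha
  have ham : Measurable a := by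
    have h1 : Measurable fun x => star (z x) := continuous_star.measurable.comp hzm
    exact h1.mul (Complex.measurable_ofReal.comp hNm.inv)
  have haC (x) : ‖a x‖ ≤ 1 := by
    rw [ha, norm_mul, norm_star, Complex.norm_real, Real.norm_eq_abs,
      abs_of_pos (inv_pos.2 (bracket_pos _)), ← div_eq_mul_inv]
    exact (div_le_one (bracket_pos _)).2 (norm_le_bracket _)
  have hai : Integrable fun t : ℝ => φ t * a t :=
    hφ.mul_bdd (c := 1) (ham.comp hmk).aestronglyMeasurable
      (Filter.Eventually.of_forall fun t => haC _)
  have hare : Integrable fun t : ℝ => (φ t * a t).re := hai.re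
  have hazero : (∫ t in Ioc (-1 : ℝ) 1, (φ t * a t).re) +
      ∫ t in (Ioc (-1 : ℝ) 1)ᶜ, (φ t * a t).re = 0 := by
    rw [integral_add_compl measurableSet_Ioc hare]
    have := integral_re hai
    simp only [RCLike.re_to_complex] at this
    rw [this, integral_mul_measurable_eq_zero hφ hm h ham haC, Complex.zero_re]
  set q : ℝ → ℝ := fun t => (1 - (bracket (z t))⁻¹) * |1 - t ^ 2|⁻¹ with hq
  have hb0 (x) : 0 ≤ 1 - (bracket (z x))⁻¹ := sub_nonneg.2 (inv_le_one_of_one_le₀ (one_le_bracket _))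
  have hq0 (t) : 0 ≤ q t := mul_nonneg (hb0 _) (by positivity)
  have hqm : Measurable q := ((hNm.comp hmk).inv.const_sub 1).mul (by fun_prop)
  have hzI {t : ℝ} (ht : t ∈ Ioc (-1 : ℝ) 1) : z t = weighted φ t := by
    simp only [hz, circleRep_coe ht]
  have hqI : IntegrableOn q (Ioc (-1 : ℝ) 1) := by
    refine Integrable.mono' hφ.norm.integrableOn hqm.aestronglyMeasurable ?_
    filter_upwards [ae_restrict_mem measurableSet_Ioc] with t ht
    rw [Real.norm_eq_abs, abs_of_nonneg (hq0 t)]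
    refine le_trans ?_ (norm_weighted_mul_inv_le φ t)
    simp only [hq, hzI ht]
    gcongr
    exact one_sub_inv_bracket_le _
  have hl : ∫⁻ t in (Ioc (-1 : ℝ) 1)ᶜ, ENNReal.ofReal (q t) =
      ∫⁻ t in Ioc (-1 : ℝ) 1, ENNReal.ofReal (q t) := by
    have := lintegral_compl_Ioc_eq (g := fun x => ENNReal.ofReal (1 - (bracket (z x))⁻¹))
      (hNm.inv.const_sub 1).ennreal_ofReal
    simpa only [hq, ENNReal.ofReal_mul (hb0 _)] using this
  have hqE : IntegrableOn q (Ioc (-1 : ℝ) 1)ᶜ := by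
    refine ⟨hqm.aestronglyMeasurable, ?_⟩
    rw [hasFiniteIntegral_iff_ofReal (Filter.Eventually.of_forall hq0), hl,
      ← hasFiniteIntegral_iff_ofReal (Filter.Eventually.of_forall hq0)]
    exact hqI.2
  have hqq : ∫ t in (Ioc (-1 : ℝ) 1)ᶜ, q t = ∫ t in Ioc (-1 : ℝ) 1, q t := by
    rw [integral_eq_lintegral_of_nonneg_ae (Filter.Eventually.of_forall hq0)
      hqm.aestronglyMeasurable, integral_eq_lintegral_of_nonneg_ae
      (Filter.Eventually.of_forall hq0) hqm.aestronglyMeasurable, hl]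
  have hI : ∫ t in Ioc (-1 : ℝ) 1, energy φ t =
      ∫ t in Ioc (-1 : ℝ) 1, ((φ t * a t).re - q t) := by
    rw [← restrict_Ioo_eq_restrict_Ioc]
    refine setIntegral_congr_fun measurableSet_Ioo fun t ht => ?_
    have hpos : 0 < 1 - t ^ 2 := by nlinarith [ht.1, ht.2]
    simp only [hq, ha, hzI (Ioo_subset_Ioc_self ht), energy]
    have hb := bracket_pos (weighted φ t)
    have hsq := sq_bracket (weighted φ t)
    have e : φ t * (star (weighted φ t) * (((bracket (weighted φ t))⁻¹ : ℝ) : ℂ)) =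
        ((‖weighted φ t‖ ^ 2 * (bracket (weighted φ t))⁻¹ * (1 - t ^ 2)⁻¹ : ℝ) : ℂ) := by
      have : φ t = weighted φ t * (((1 - t ^ 2)⁻¹ : ℝ) : ℂ) := by
        rw [weighted, mul_assoc, ← Complex.ofReal_mul, mul_inv_cancel₀ hpos.ne']
        simp
      conv_lhs => rw [this]
      have h2 : weighted φ t * star (weighted φ t) = ((‖weighted φ t‖ ^ 2 : ℝ) : ℂ) := by
        simpa using Complex.mul_conj' (weighted φ t)
      rw [Complex.ofReal_mul, Complex.ofReal_mul, ← h2]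
      ring
    rw [e, Complex.ofReal_re, abs_of_pos hpos]
    field_simp
    nlinarith
  have hDeq {t : ℝ} (ht : t ∈ (Ioc (-1 : ℝ) 1)ᶜ) (ht' : t ≠ -1) :
      energy φ t + q t + (φ t * a t).re = (bracket (z t) * bracket (weighted φ t) -
        (1 + (star (z t) * weighted φ t).re)) * ((bracket (z t))⁻¹ * |1 - t ^ 2|⁻¹) := by
    have hneg : 1 - t ^ 2 < 0 := by
      by_contra! hc
      have := abs_le_one_iff_mul_self_le_one.2 (by nlinarith : t * t ≤ 1)
      obtain ⟨h1, h2⟩ := abs_le.1 this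
      exact ht ⟨lt_of_le_of_ne h1 ht'.symm, h2⟩
    have e : φ t = weighted φ t * (((1 - t ^ 2)⁻¹ : ℝ) : ℂ) := by
      rw [weighted, mul_assoc, ← Complex.ofReal_mul, mul_inv_cancel₀ hneg.ne]
      simp
    have e2 : (φ t * a t).re =
        (star (z t) * weighted φ t).re * (bracket (z t))⁻¹ * (1 - t ^ 2)⁻¹ := by
      have : φ t * a t = star (z t) * weighted φ t *
          (((bracket (z t))⁻¹ * (1 - t ^ 2)⁻¹ : ℝ) : ℂ) := by
        conv_lhs => rw [e]
        rw [ha, Complex.ofReal_mul]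
        ring
      rw [this, Complex.re_mul_ofReal, mul_assoc]
    rw [e2]
    simp only [energy, hq, abs_of_neg hneg]
    have := (bracket_pos (z t)).ne'
    have := hneg.ne
    field_simp
    ring
  have hEae : ∀ᵐ t ∂volume.restrict (Ioc (-1 : ℝ) 1)ᶜ,
      t ∈ (Ioc (-1 : ℝ) 1)ᶜ ∧ t ≠ -1 := by
    filter_upwards [ae_restrict_mem measurableSet_Ioc.compl,
      ae_restrict_of_ae (Measure.ae_ne volume (-1 : ℝ))] with t h1 h2 using ⟨h1, h2⟩
  have hD0 : 0 ≤ᵐ[volume.restrict (Ioc (-1 : ℝ) 1)ᶜ]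
      fun t => energy φ t + q t + (φ t * a t).re := by
    filter_upwards [hEae] with t ht
    rw [hDeq ht.1 ht.2]
    refine mul_nonneg (sub_nonneg.2 (one_add_re_le_bracket_mul_bracket _ _)) ?_
    have := bracket_pos (z t)
    positivity
  have hk := integrable_energy hφ hm
  have hDint : IntegrableOn (fun t => energy φ t + q t + (φ t * a t).re) (Ioc (-1 : ℝ) 1)ᶜ :=
    (hk.integrableOn.add hqE).add hare.integrableOn
  have hDI : ∫ t in (Ioc (-1 : ℝ) 1)ᶜ, (energy φ t + q t + (φ t * a t).re) =
      (∫ t in (Ioc (-1 : ℝ) 1)ᶜ, energy φ t) - ∫ t in Ioc (-1 : ℝ) 1, energy φ t := by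
    rw [integral_add (f := fun t => energy φ t + q t) (hk.integrableOn.add hqE) hare.integrableOn,
      integral_add hk.integrableOn hqE,
      hI, integral_sub hare.integrableOn hqI, hqq]
    linarith
  refine ⟨?_, fun hle => ?_⟩
  · have := integral_nonneg_of_ae hD0
    rw [hDI] at this
    linarith
  · have h0 := (integral_eq_zero_iff_of_nonneg_ae hD0 hDint).1
      (le_antisymm (by rw [hDI]; linarith) (integral_nonneg_of_ae hD0))
    rw [← ae_restrict_iff' measurableSet_Ioc.compl]
    filter_upwards [h0, hEae] with t h1 ht
    rw [hDeq ht.1 ht.2] at h1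
    have hne : |1 - t ^ 2| ≠ 0 := by
      rw [abs_ne_zero]
      intro hc
      have : (1 - t) * (1 + t) = 0 := by linarith
      rcases mul_eq_zero.1 this with h | h
      · exact ht.1 ⟨by linarith, by linarith⟩
      · exact ht.2 (by linarith)
    have hne2 := (bracket_pos (z t)).ne'
    refine eq_of_bracket_mul_bracket_eq (sub_eq_zero.1 ?_)
    exact (mul_eq_zero.1 h1).resolve_right (mul_ne_zero (inv_ne_zero hne2) (inv_ne_zero hne))

theorem tsum_ofReal_inv_two_mul_add_two :
    ∑' n : ℕ, ENNReal.ofReal (2 * n + 2 : ℝ)⁻¹ = ∞ := by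
  by_contra h
  have hs := ENNReal.summable_toReal h
  have h1 : Summable fun n : ℕ => 2 * (2 * n + 2 : ℝ)⁻¹ := by
    refine Summable.mul_left 2 (hs.congr fun n => ?_)
    exact ENNReal.toReal_ofReal (by positivity)
  refine Real.not_summable_one_div_natCast ((summable_nat_add_iff 1).1 (h1.congr fun n => ?_))
  push_cast
  field_simp

theorem iUnion_Ioc_half_add_natCast :
    ⋃ n : ℕ, Ioc (1 / 2 + n : ℝ) (3 / 2 + n) = Ioi (1 / 2) := by
  ext w
  simp only [mem_iUnion, mem_Ioc, mem_Ioi]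
  constructor
  · rintro ⟨n, h, -⟩
    have : (0 : ℝ) ≤ n := n.cast_nonneg
    linarith
  · intro hw
    have hpos : 0 < ⌈w - 1 / 2⌉₊ := Nat.ceil_pos.2 (by linarith)
    obtain ⟨n, hn⟩ := Nat.exists_eq_succ_of_ne_zero hpos.ne'
    refine ⟨n, ?_, ?_⟩
    · have : n < ⌈w - 1 / 2⌉₊ := by omega
      have := Nat.lt_ceil.1 this
      linarith
    · have := Nat.le_ceil (w - 1 / 2)
      rw [hn] at this
      push_cast at this
      linarith

theorem setLIntegral_Ioi_half_eq_tsum (f : ℝ → ℝ≥0∞) :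
    ∫⁻ w in Ioi (1 / 2 : ℝ), f w = ∑' n : ℕ, ∫⁻ w in Ioc (1 / 2 : ℝ) (3 / 2), f (w + n) := by
  have hd : Pairwise (Function.onFun Disjoint fun n : ℕ => Ioc (1 / 2 + n : ℝ) (3 / 2 + n)) := by
    have hmono : Monotone fun n : ℕ => (1 / 2 + n : ℝ) := fun a b h => by simpa using h
    convert hmono.pairwise_disjoint_on_Ioc_succ using 3 with n
    rw [Order.succ_eq_add_one]
    push_cast
    congr 1
    ring
  rw [← iUnion_Ioc_half_add_natCast, lintegral_iUnion (fun _ => measurableSet_Ioc) hd]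
  congr 1 with n
  rw [← (measurePreserving_add_right volume (n : ℝ)).setLIntegral_comp_preimage_emb
    (MeasurableEquiv.addRight _).measurableEmbedding]
  congr 2
  ext t
  simp

theorem ae_eq_zero_of_ae_add_one_eq {W : ℝ → ℝ≥0∞} (hW : Measurable W)
    (hinv : ∀ᵐ w : ℝ, w ∈ Ioi (1 / 2 : ℝ) → W (w + 1) = W w)
    (hfin : ∫⁻ w in Ioi (1 / 2 : ℝ), W w * ENNReal.ofReal (2 * w - 1)⁻¹ ≠ ∞) :
    ∫⁻ w in Ioi (1 / 2 : ℝ), W w * ENNReal.ofReal (2 * w - 1)⁻¹ = 0 := by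
  have hn (n : ℕ) : ∀ᵐ w : ℝ, w ∈ Ioi (1 / 2 : ℝ) → W (w + n) = W w := by
    induction n with
    | zero => simp
    | succ n ih =>
      filter_upwards [ih,
        (measurePreserving_add_right volume (n : ℝ)).quasiMeasurePreserving.ae hinv] with w h1 h2 hw
      rw [← h1 hw, ← h2 (mem_Ioi.2 (by
        have : (0 : ℝ) ≤ n := n.cast_nonneg
        have : 1 / 2 < w := hw
        linarith))]
      congr 1
      push_cast
      ring
  rw [setLIntegral_Ioi_half_eq_tsum] at hfin ⊢
  have hterm (n : ℕ) : ∫⁻ w in Ioc (1 / 2 : ℝ) (3 / 2),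
      W (w + n) * ENNReal.ofReal (2 * (w + n) - 1)⁻¹ =
      ∫⁻ w in Ioc (1 / 2 : ℝ) (3 / 2), W w * ENNReal.ofReal (2 * (w + n) - 1)⁻¹ := by
    refine setLIntegral_congr_fun_ae measurableSet_Ioc ?_
    filter_upwards [hn n] with w h hw
    rw [h hw.1]
  simp_rw [hterm] at hfin ⊢
  have hzero : ∫⁻ w in Ioc (1 / 2 : ℝ) (3 / 2), W w = 0 := by
    by_contra hne
    refine hfin (top_unique ?_)
    calc ∞ = ∑' n : ℕ, (∫⁻ w in Ioc (1 / 2 : ℝ) (3 / 2), W w) * ENNReal.ofReal (2 * n + 2 : ℝ)⁻¹ := by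
          rw [ENNReal.tsum_mul_left, tsum_ofReal_inv_two_mul_add_two, ENNReal.mul_top hne]
      _ ≤ _ := by
          refine ENNReal.tsum_le_tsum fun n => ?_
          rw [← lintegral_mul_const _ hW]
          refine setLIntegral_mono' measurableSet_Ioc fun w hw => ?_
          have : (0 : ℝ) ≤ n := n.cast_nonneg
          gcongr
          · linarith [hw.1]
          · linarith [hw.2]
  have hae := (lintegral_eq_zero_iff hW).1 hzero
  refine ENNReal.tsum_eq_zero.2 fun n => ?_
  rw [lintegral_eq_zero_iff (by fun_prop)]
  filter_upwards [hae] with w hw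
  simp only [Pi.zero_apply] at hw ⊢
  rw [hw, zero_mul]

/-- A function invariant under the parabolic map `s ↦ 1 / (2 - s)` fixing `1` and integrable against
`ds / (1 - s²)` vanishes. -/
theorem ae_eq_zero_of_parabolic_invariant {U : ℝ → ℝ≥0∞} (hU : Measurable U)
    (hinv : ∀ᵐ s : ℝ, s ∈ Ioo (-1 : ℝ) 1 → U (2 - s)⁻¹ = U s)
    (hfin : ∫⁻ s in Ioo (-1 : ℝ) 1, U s * ENNReal.ofReal |1 - s ^ 2|⁻¹ ≠ ∞) :
    ∀ᵐ s : ℝ, s ∈ Ioo (-1 : ℝ) 1 → U s = 0 := by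
  have himg : (fun w : ℝ => 1 - w⁻¹) '' Ioi (1 / 2 : ℝ) = Ioo (-1) 1 := by
    ext s
    simp only [mem_image, mem_Ioi, mem_Ioo]
    constructor
    · rintro ⟨w, hw, rfl⟩
      have h0 : 0 < w := by linarith
      have h1 : 0 < w⁻¹ := by positivity
      have h2 : w⁻¹ < 2 := by
        rw [inv_lt_comm₀ h0 two_pos]
        linarith
      constructor <;> linarith
    · rintro ⟨h1, h2⟩
      refine ⟨(1 - s)⁻¹, ?_, by simp⟩
      rw [one_div, inv_lt_inv₀ two_pos (by linarith)]
      linarith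
  have hcov := lintegral_image_eq_lintegral_abs_deriv_mul (s := Ioi (1 / 2 : ℝ))
    (f := fun w => 1 - w⁻¹) (f' := fun w => (w ^ 2)⁻¹) measurableSet_Ioi
    (fun w hw => by
      have h0 : w ≠ 0 := by
        have : 1 / 2 < w := hw
        linarith
      simpa using ((hasDerivAt_inv h0).const_sub 1).hasDerivWithinAt)
    (fun x _ y _ h => by simpa using h)
    (fun s => U s * ENNReal.ofReal |1 - s ^ 2|⁻¹)
  have hcongr : ∫⁻ w in Ioi (1 / 2 : ℝ), ENNReal.ofReal |(w ^ 2)⁻¹| *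
      (U (1 - w⁻¹) * ENNReal.ofReal |1 - (1 - w⁻¹) ^ 2|⁻¹) =
      ∫⁻ w in Ioi (1 / 2 : ℝ), U (1 - w⁻¹) * ENNReal.ofReal (2 * w - 1)⁻¹ := by
    refine setLIntegral_congr_fun measurableSet_Ioi fun w hw => ?_
    have hw' : 1 / 2 < w := hw
    have h0 : 0 < w := by linarith
    have h1 : 0 < 2 * w - 1 := by linarith
    rw [mul_left_comm, ← ENNReal.ofReal_mul (abs_nonneg _)]
    congr 2
    have : 1 - (1 - w⁻¹) ^ 2 = (2 * w - 1) * (w ^ 2)⁻¹ := by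
      field_simp
      ring
    rw [this, abs_of_pos (by positivity), abs_of_pos (by positivity)]
    field_simp
  rw [himg, hcongr] at hcov
  have hWm : Measurable fun w : ℝ => U (1 - w⁻¹) := hU.comp (by fun_prop)
  have hz : ∫⁻ s in Ioo (-1 : ℝ) 1, U s * ENNReal.ofReal |1 - s ^ 2|⁻¹ = 0 := by
    rw [hcov] at hfin ⊢
    refine ae_eq_zero_of_ae_add_one_eq hWm ?_ hfin
    set N : Set ℝ := {s | ¬ (s ∈ Ioo (-1 : ℝ) 1 → U (2 - s)⁻¹ = U s)} with hN
    have hNsub : N ⊆ Ioo (-1) 1 := fun s hs => by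
      simp only [hN, mem_ofPred_eq, Classical.not_imp] at hs
      exact hs.1
    have hN0 : volume N = 0 := hinv
    have himgN := addHaar_image_eq_zero_of_differentiableOn_of_addHaar_eq_zero volume
      (f := fun s : ℝ => (1 - s)⁻¹) (s := N) (fun s hs => by
        have : 1 - s ≠ 0 := by linarith [(hNsub hs).2]
        exact ((differentiableAt_id.const_sub 1).inv this).differentiableWithinAt) hN0
    refine measure_mono_null (fun w hw => ?_) himgN
    simp only [mem_compl_iff, mem_ofPred_eq, Classical.not_imp] at hw
    obtain ⟨hw, hne⟩ := hw
    refine ⟨1 - w⁻¹, ?_, by simp⟩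
    simp only [hN, mem_ofPred_eq, Classical.not_imp]
    refine ⟨himg ▸ mem_image_of_mem _ hw, fun h => hne ?_⟩
    rw [← h]
    congr 1
    have hw' : 1 / 2 < w := hw
    have h0 : w ≠ 0 := by linarith
    have h1 : w + 1 ≠ 0 := by linarith
    have h2 : 2 - (1 - w⁻¹) = (w + 1) / w := by
      field_simp
      ring
    rw [h2]
    field_simp
    ring
  rw [lintegral_eq_zero_iff (by fun_prop)] at hz
  rw [← ae_restrict_iff' measurableSet_Ioo]
  filter_upwards [hz, ae_restrict_mem measurableSet_Ioo] with s hs hm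
  refine (mul_eq_zero.1 hs).resolve_right ?_
  have : 0 < |1 - s ^ 2| := abs_pos.2 (by nlinarith [hm.1, hm.2])
  simpa using this

/-- The density `φ(-1/s) / s²`, the pullback of `φ(t) dt` under `t = -1/s`. -/
noncomputable def inverted (φ : ℝ → ℂ) (s : ℝ) : ℂ := φ (-s⁻¹) * ((s ^ 2)⁻¹ : ℝ)

theorem measurable_inverted {φ : ℝ → ℂ} (hm : Measurable φ) : Measurable (inverted φ) := by
  unfold inverted
  fun_prop

theorem weighted_inverted (φ : ℝ → ℂ) {s : ℝ} (hs : s ≠ 0) :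
    weighted (inverted φ) s = -weighted φ (-s⁻¹) := by
  have e : (s ^ 2)⁻¹ * (1 - s ^ 2) = -(1 - (-s⁻¹) ^ 2) := by
    field_simp
    ring
  rw [weighted, weighted, inverted, mul_assoc, ← Complex.ofReal_mul, e, Complex.ofReal_neg, mul_neg]

theorem bracket_neg (z : ℂ) : bracket (-z) = bracket z := by
  rw [bracket, bracket, norm_neg]

theorem energy_inverted (φ : ℝ → ℂ) {s : ℝ} (hs : s ≠ 0) :
    energy (inverted φ) s = |(s ^ 2)⁻¹| * energy φ (-s⁻¹) := by
  have e : (1 - s ^ 2) = (s ^ 2) * -(1 - (-s⁻¹) ^ 2) := by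
    field_simp
    ring
  rw [energy, energy, weighted_inverted φ hs, bracket_neg, e, abs_mul, abs_neg, mul_inv, abs_inv]
  ring

theorem hasDerivWithinAt_neg_inv {x : ℝ} (hx : x ≠ 0) (s : Set ℝ) :
    HasDerivWithinAt (fun x : ℝ => -x⁻¹) (x ^ 2)⁻¹ s x :=
  (hasDerivAt_inv hx).neg.hasDerivWithinAt.congr_deriv (neg_neg _)

theorem injOn_neg_inv (s : Set ℝ) : InjOn (fun x : ℝ => -x⁻¹) s :=
  fun x _ y _ h => by simpa using h

theorem image_neg_inv (s : Set ℝ) : (fun x : ℝ => -x⁻¹) '' s = (fun x : ℝ => -x⁻¹) ⁻¹' s :=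
  congrFun (image_eq_preimage_of_inverse (fun x => by simp [inv_neg]) (fun x => by simp [inv_neg])) s

theorem image_neg_inv_compl_Ioc :
    (fun x : ℝ => -x⁻¹) '' (Ioc (-1 : ℝ) 1)ᶜ = Ioc (-1 : ℝ) 1 \ {0} := by
  rw [image_neg_inv]
  ext x
  simp only [mem_preimage, mem_compl_iff, mem_Ioc, mem_sdiff, mem_singleton_iff]
  rcases lt_trichotomy x 0 with hx | rfl | hx
  · have h1 : 0 < -x⁻¹ := by simpa using hx
    have h2 : -x⁻¹ ≤ 1 ↔ x ≤ -1 := by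
      rw [← inv_neg, inv_le_one₀ (by linarith)]
      constructor <;> intro <;> linarith
    rw [h2]
    constructor
    · intro h
      have : ¬ x ≤ -1 := fun h' => h ⟨by linarith, h'⟩
      exact ⟨⟨by linarith, by linarith⟩, hx.ne⟩
    · rintro ⟨⟨h3, -⟩, -⟩ ⟨-, h4⟩
      linarith
  · simp
  · have h1 : 0 < x⁻¹ := by simpa using hx
    have h2 : -1 < -x⁻¹ ↔ 1 < x := by
      rw [neg_lt_neg_iff, inv_lt_one₀ hx]
    rw [h2]
    constructor
    · intro h
      have : ¬ 1 < x := fun h' => h ⟨h', by linarith⟩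
      exact ⟨⟨by linarith, by linarith⟩, hx.ne'⟩
    · rintro ⟨⟨-, h3⟩, -⟩ ⟨h4, -⟩
      linarith

theorem image_neg_inv_Ioc :
    (fun x : ℝ => -x⁻¹) '' (Ioc (-1 : ℝ) 1 \ {0}) = (Ioc (-1 : ℝ) 1)ᶜ := by
  rw [← image_neg_inv_compl_Ioc, image_image]
  simp [inv_neg]

theorem integrable_inverted {φ : ℝ → ℂ} (hφ : Integrable φ) : Integrable (inverted φ) := by
  have h := (integrableOn_image_iff_integrableOn_abs_deriv_smul
    (measurableSet_singleton (0 : ℝ)).compl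
    (fun x hx => hasDerivWithinAt_neg_inv hx _) (injOn_neg_inv _) φ).1 hφ.integrableOn
  have hr : volume.restrict ({0}ᶜ : Set ℝ) = volume :=
    Measure.restrict_eq_self_of_ae_mem (Measure.ae_ne volume 0)
  rw [IntegrableOn, hr] at h
  refine h.congr (Filter.Eventually.of_forall fun x => ?_)
  simp only [inverted, abs_of_nonneg (by positivity : 0 ≤ (x ^ 2)⁻¹), Complex.real_smul]
  exact mul_comm _ _

theorem integral_mul_inverted (φ : ℝ → ℂ) (g : ℝ → ℂ) :
    ∫ s, g s * inverted φ s = ∫ t, g (-t⁻¹) * φ t := by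
  have h := integral_image_eq_integral_abs_deriv_smul
    (measurableSet_singleton (0 : ℝ)).compl
    (fun x hx => hasDerivWithinAt_neg_inv hx _) (injOn_neg_inv _) fun t => g (-t⁻¹) * φ t
  have hr : volume.restrict ({0}ᶜ : Set ℝ) = volume :=
    Measure.restrict_eq_self_of_ae_mem (Measure.ae_ne volume 0)
  have hi : (fun x : ℝ => -x⁻¹) '' {0}ᶜ = {0}ᶜ := by
    rw [image_neg_inv]
    ext x
    simp
  rw [hi, hr] at h
  rw [h]
  congr 1 with x
  simp only [inverted, abs_of_nonneg (by positivity : 0 ≤ (x ^ 2)⁻¹), Complex.real_smul, inv_neg,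
    inv_inv, neg_neg]
  ring

theorem setIntegral_energy_inverted_compl_Ioc (φ : ℝ → ℂ) :
    ∫ s in (Ioc (-1 : ℝ) 1)ᶜ, energy (inverted φ) s = ∫ t in Ioc (-1 : ℝ) 1, energy φ t := by
  have h0 : ∀ x ∈ (Ioc (-1 : ℝ) 1)ᶜ, x ≠ 0 := by
    rintro x hx rfl
    exact hx ⟨by norm_num, by norm_num⟩
  have h := integral_image_eq_integral_abs_deriv_smul measurableSet_Ioc.compl
    (fun x hx => hasDerivWithinAt_neg_inv (h0 x hx) _) (injOn_neg_inv _) (energy φ)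
  rw [image_neg_inv_compl_Ioc, setIntegral_congr_set (sdiff_null_ae_eq_self (by simp))] at h
  rw [h]
  exact setIntegral_congr_fun measurableSet_Ioc.compl fun s hs => energy_inverted φ (h0 s hs)

theorem setIntegral_energy_inverted_Ioc (φ : ℝ → ℂ) :
    ∫ s in Ioc (-1 : ℝ) 1, energy (inverted φ) s = ∫ t in (Ioc (-1 : ℝ) 1)ᶜ, energy φ t := by
  have hm : MeasurableSet (Ioc (-1 : ℝ) 1 \ {0}) :=
    measurableSet_Ioc.diff (measurableSet_singleton _)
  have h := integral_image_eq_integral_abs_deriv_smul hm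
    (fun x hx => hasDerivWithinAt_neg_inv hx.2 _) (injOn_neg_inv _) (energy φ)
  rw [image_neg_inv_Ioc] at h
  rw [h, ← setIntegral_congr_set (sdiff_null_ae_eq_self (by simp) : (Ioc (-1 : ℝ) 1 \ {0} : Set ℝ) =ᵐ[volume] _)]
  exact setIntegral_congr_fun hm fun s hs => energy_inverted φ hs.2

theorem ae_weighted_sub_two_eq {φ : ℝ → ℂ}
    (h : ∀ᵐ t : ℝ, t ∈ (Ioc (-1 : ℝ) 1)ᶜ → weighted φ t = weighted φ (circleRep t)) :
    ∀ᵐ s : ℝ, s ∈ Ioo (-1 : ℝ) 1 → weighted φ (s - 2) = weighted φ s := by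
  filter_upwards [(measurePreserving_sub_right volume (2 : ℝ)).quasiMeasurePreserving.ae h]
    with s hs hI
  have hc : ((s - 2 : ℝ) : AddCircle (2 : ℝ)) = s := by
    rw [AddCircle.coe_sub, AddCircle.coe_period, sub_zero]
  rw [hs fun hmem => by linarith [hmem.1, hI.2], hc, circleRep_coe (Ioo_subset_Ioc_self hI)]

theorem enorm_weighted_mul_le (φ : ℝ → ℂ) (t : ℝ) :
    ‖weighted φ t‖ₑ * ENNReal.ofReal |1 - t ^ 2|⁻¹ ≤ ‖φ t‖ₑ := by
  rw [← ofReal_norm, ← ofReal_norm, ← ENNReal.ofReal_mul (norm_nonneg _)]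
  exact ENNReal.ofReal_le_ofReal (norm_weighted_mul_inv_le φ t)

theorem ae_eq_zero_of_measurable {φ : ℝ → ℂ} (hφ : Integrable φ) (hm : Measurable φ)
    (h1 : ∀ n : ℤ, ∫ t : ℝ, Complex.exp (Complex.I * (Real.pi : ℂ) * (n : ℂ) * (t : ℂ)) * φ t = 0)
    (h2 : ∀ n : ℤ, ∫ t : ℝ,
      Complex.exp (-(Complex.I * (Real.pi : ℂ) * (n : ℂ)) / (t : ℂ)) * φ t = 0) :
    ∀ᵐ t : ℝ, φ t = 0 := by
  have hψ := integrable_inverted hφ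
  have hψm := measurable_inverted hm
  have h2' (n : ℤ) : ∫ s : ℝ,
      Complex.exp (Complex.I * (Real.pi : ℂ) * (n : ℂ) * (s : ℂ)) * inverted φ s = 0 := by
    rw [integral_mul_inverted φ
      fun s : ℝ => Complex.exp (Complex.I * (Real.pi : ℂ) * (n : ℂ) * (s : ℂ)), ← h2 n]
    congr 1 with t
    push_cast
    congr 2
    ring
  obtain ⟨hA, hA'⟩ := setIntegral_energy_le_compl hφ hm h1
  obtain ⟨hB, hB'⟩ := setIntegral_energy_le_compl hψ hψm h2'
  rw [setIntegral_energy_inverted_compl_Ioc, setIntegral_energy_inverted_Ioc] at hB hB'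
  have hφ2 := ae_weighted_sub_two_eq (hA' hB)
  have hψ2 := ae_weighted_sub_two_eq (hB' hA)
  have hU : Measurable fun s => ‖weighted φ s‖ₑ + ‖weighted (inverted φ) s‖ₑ :=
    (measurable_weighted hm).enorm.add (measurable_weighted hψm).enorm
  have hz := ae_eq_zero_of_parabolic_invariant hU (by
    filter_upwards [hφ2, hψ2] with s h3 h4 hs
    have hne : 2 - s ≠ 0 := by linarith [hs.2]
    have e1 := weighted_inverted φ (inv_ne_zero hne)
    have e2 := weighted_inverted φ (s := s - 2) (by linarith [hs.2])
    rw [inv_inv, neg_sub, h3 hs] at e1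
    rw [← inv_neg, neg_sub, h4 hs] at e2
    rw [e1, e2, enorm_neg, enorm_neg, add_comm]) (by
    refine ne_top_of_le_ne_top (ENNReal.add_ne_top.2 ⟨hφ.2.ne, hψ.2.ne⟩) ?_
    rw [← lintegral_add_left hm.enorm]
    refine (setLIntegral_le_lintegral _ _).trans' (lintegral_mono fun s => ?_)
    rw [add_mul]
    exact add_le_add (enorm_weighted_mul_le φ s) (enorm_weighted_mul_le _ s))
  have hw0 {f : ℝ → ℂ} {s : ℝ} (hs : s ∈ Ioo (-1 : ℝ) 1) (h : weighted f s = 0) : f s = 0 := by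
    refine (mul_eq_zero.1 h).resolve_right (Complex.ofReal_ne_zero.2 ?_)
    nlinarith [hs.1, hs.2]
  have hout : volume {t : ℝ | ¬ (t ∉ Icc (-1 : ℝ) 1 → φ t = 0)} = 0 := by
    set N : Set ℝ := {s | ¬ (s ∈ Ioo (-1 : ℝ) 1 →
      ‖weighted φ s‖ₑ + ‖weighted (inverted φ) s‖ₑ = 0)} \ {0} with hN
    have hN0 : volume N = 0 := measure_mono_null sdiff_subset hz
    have himg := addHaar_image_eq_zero_of_differentiableOn_of_addHaar_eq_zero volume
      (f := fun s : ℝ => -s⁻¹) (s := N)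
      (fun s hs => (hasDerivWithinAt_neg_inv hs.2 _).differentiableWithinAt) hN0
    refine measure_mono_null (fun t ht => ?_) himg
    simp only [mem_ofPred_eq, Classical.not_imp] at ht
    obtain ⟨ht, hne⟩ := ht
    have ht0 : t ≠ 0 := by
      rintro rfl
      exact ht ⟨by norm_num, by norm_num⟩
    have habs : |t⁻¹| < 1 := by
      rw [abs_inv]
      exact inv_lt_one_of_one_lt₀ (not_le.1 fun h => ht (abs_le.1 h))
    have hmem : -t⁻¹ ∈ Ioo (-1 : ℝ) 1 := by
      rw [← abs_neg] at habs
      exact abs_lt.1 habs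
    refine ⟨-t⁻¹, ⟨?_, by simpa using ht0⟩, by simp [inv_neg]⟩
    simp only [mem_ofPred_eq, Classical.not_imp]
    refine ⟨hmem, fun h => hne ?_⟩
    have h0 := hw0 hmem (enorm_eq_zero.1 (add_eq_zero.1 h).2)
    simpa [inverted, inv_neg, ht0] using h0
  filter_upwards [hz, hout, Measure.ae_ne volume (-1 : ℝ), Measure.ae_ne volume (1 : ℝ)]
    with t h3 h4 h5 h6
  by_cases ht : t ∈ Icc (-1 : ℝ) 1
  · have ht' : t ∈ Ioo (-1 : ℝ) 1 := ⟨lt_of_le_of_ne ht.1 h5.symm, lt_of_le_of_ne ht.2 h6⟩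
    exact hw0 ht' (enorm_eq_zero.1 (add_eq_zero.1 (h3 ht')).1)
  · exact h4 ht

/-- If `φ ∈ L¹(ℝ)` satisfies `∫ e^{iπnt} φ(t) dt = 0` and
`∫ e^{-iπn/t} φ(t) dt = 0` for every integer `n`, then `φ = 0` a.e. -/
theorem statement0 (φ : ℝ → ℂ) (hφ : Integrable φ)
    (h1 : ∀ n : ℤ, ∫ t : ℝ, Complex.exp (Complex.I * (Real.pi : ℂ) * (n : ℂ) * (t : ℂ)) * φ t = 0)
    (h2 : ∀ n : ℤ, ∫ t : ℝ, Complex.exp (-(Complex.I * (Real.pi : ℂ) * (n : ℂ)) / (t : ℂ)) * φ t = 0) :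
    ∀ᵐ t : ℝ ∂(volume : Measure ℝ), φ t = 0 := by
  have hae := hφ.1.ae_eq_mk
  have h (g : ℝ → ℂ) : ∫ t, g t * hφ.1.mk φ t = ∫ t, g t * φ t :=
    integral_congr_ae (by filter_upwards [hae] with t ht using by rw [ht])
  filter_upwards [hae, ae_eq_zero_of_measurable (hφ.congr hae) hφ.1.stronglyMeasurable_mk.measurable
    (fun n => (h _).trans (h1 n)) (fun n => (h _).trans (h2 n))] with t h3 h4
  rw [h3, h4]
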